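/- (Lemma 3.4.) For every integer n, every integer i ≥ 1 and every partition λ, one has Y_n(λ↑i) · Y_{n−1}(λ)^{−1} = Y(|λ↑i| − |λ| + n − 1, |λ↑i| − |λ|). -/

import Mathlib

/-- A partition, recorded by its parts: `f k` is the `(k+1)`-st part `λ_{k+1}`
(0-indexed), so the parts are weakly decreasing and eventually zero. -/
def IsPartition (f : ℕ → ℕ) : Prop :=
  (∀ k, f (k + 1) ≤ f k) ∧ ∃ N, f N = 0

/-- `|λ|`, the size (sum of the parts) of a partition. -/
noncomputable def psize (f : ℕ → ℕ) : ℕ := ∑' k, f k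

/-- `ℓ(λ)`, the number of nonzero parts of a partition. -/
noncomputable def plength (f : ℕ → ℕ) : ℕ := Set.ncard {k | f k ≠ 0}

/-- `u_i(λ)`, the number of parts of `λ` that are `≥ i`. -/
noncomputable def ucount (f : ℕ → ℕ) (i : ℕ) : ℕ := Set.ncard {k | i ≤ f k}

/-- `λ↑i`: the parts `λ_1,…,λ_{u_i(λ)}` each lose one, a new part `i - 1` is inserted
at (1-indexed) position `u_i(λ) + 1`, and the remaining parts are unchanged
(trailing zeros are irrelevant in this representation). -/
noncomputable def upP (f : ℕ → ℕ) (i : ℕ) : ℕ → ℕ := fun k =>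
  if k < ucount f i then f k - 1
  else if k = ucount f i then i - 1
  else f (k - 1)

/-- `λ↓j`: the (1-indexed) part `λ_j` is removed and the parts before it each gain one
(trailing zeros are irrelevant in this representation). -/
def downP (f : ℕ → ℕ) (j : ℕ) : ℕ → ℕ := fun k =>
  if k + 1 < j then f k + 1 else f (k + 1)

variable {G : Type*} [CommGroup G]

/-- The shifted product `Y(m,k)`: `∏_{j=1}^{k} y_{m+1-j}` for `k ≥ 1`, `1` for `k = 0`,
and `Y(m-k,-k)⁻¹` for `k ≤ -1`. -/
noncomputable def Yfun (y : ℤ → G) (m k : ℤ) : G :=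
  if 1 ≤ k then ∏ j ∈ Finset.range k.toNat, y (m - j)
  else if k = 0 then 1
  else (∏ j ∈ Finset.range (-k).toNat, y (m - k - j))⁻¹

/-- The shifted content product `Y_n(λ) = ∏_{i=1}^{ℓ(λ)} Y(λ_i - i + n, λ_i)`. -/
noncomputable def Ynl (y : ℤ → G) (f : ℕ → ℕ) (n : ℤ) : G :=
  ∏ k ∈ Finset.range (plength f), Yfun y ((f k : ℤ) - ((k : ℤ) + 1) + n) (f k)

theorem IsPartition.antitone {f : ℕ → ℕ} (hf : IsPartition f) : Antitone f :=
  antitone_nat_of_succ_le hf.1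

theorem IsPartition.le_iff_lt_ucount {f : ℕ → ℕ} (hf : IsPartition f) {i : ℕ} (hi : 1 ≤ i)
    (k : ℕ) : i ≤ f k ↔ k < ucount f i := by
  obtain ⟨N, hN⟩ := hf.2
  have hex : ∃ m, f m < i := ⟨N, by omega⟩
  have hset : {k | i ≤ f k} = Set.Iio (Nat.find hex) := by
    ext k
    simp only [Set.mem_ofPred_eq, Set.mem_Iio, Nat.lt_find_iff, not_lt]
    exact ⟨fun h m hm => h.trans (hf.antitone hm), fun h => h k le_rfl⟩
  have hu : ucount f i = Nat.find hex := by
    rw [ucount, hset, ← Finset.coe_Iio, Set.ncard_coe_finset, Nat.card_Iio]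
  rw [hu]
  exact Set.ext_iff.mp hset k

theorem IsPartition.upP {f : ℕ → ℕ} (hf : IsPartition f) {i : ℕ} (hi : 1 ≤ i) :
    IsPartition (upP f i) := by
  have hu := hf.le_iff_lt_ucount hi
  refine ⟨fun k => ?_, ?_⟩
  · have h0 := hu k
    have h1 := hf.1 k
    have h2 := hf.antitone (Nat.sub_le k 1)
    simp only [_root_.upP, Nat.add_sub_cancel]
    split_ifs <;> omega
  · obtain ⟨N, hN⟩ := hf.2
    refine ⟨N + ucount f i + 1, ?_⟩
    have h := hf.antitone (Nat.le_add_right N (ucount f i))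
    simp only [_root_.upP, Nat.add_sub_cancel]
    split_ifs <;> omega

theorem IsPartition.psize_eq_sum {f : ℕ → ℕ} (hf : IsPartition f) {N : ℕ} (hN : f N = 0) :
    psize f = ∑ k ∈ Finset.range N, f k :=
  tsum_eq_sum fun k hk => by
    have := hf.antitone (not_lt.mp (mt Finset.mem_range.mpr hk))
    omega

theorem Yfun_zero (y : ℤ → G) (m : ℤ) : Yfun y m 0 = 1 := by simp [Yfun]

theorem Yfun_natCast (y : ℤ → G) (m : ℤ) (k : ℕ) :
    Yfun y m k = ∏ j ∈ Finset.range k, y (m - j) := by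
  rcases k.eq_zero_or_pos with rfl | hk
  · simp [Yfun]
  · rw [Yfun, if_pos (by omega), Int.toNat_natCast]

theorem Yfun_neg_natCast (y : ℤ → G) (m : ℤ) (k : ℕ) :
    Yfun y m (-k) = (Yfun y (m + k) k)⁻¹ := by
  rcases k.eq_zero_or_pos with rfl | hk
  · simp [Yfun]
  · rw [Yfun_natCast, Yfun, if_neg (by omega), if_neg (by omega), neg_neg, Int.toNat_natCast,
      sub_neg_eq_add]

theorem Yfun_self_add_one (y : ℤ → G) (m : ℤ) :
    Yfun y (m + 1) (m + 1) = Yfun y m m * y (m + 1) := by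
  rcases m with k | k
  · have h : Int.ofNat k + 1 = ((k + 1 : ℕ) : ℤ) := by simp
    rw [h, Int.ofNat_eq_natCast, Yfun_natCast, Yfun_natCast, Finset.prod_range_succ']
    simp
  · have h : Int.negSucc k + 1 = -(k : ℤ) := by omega
    have h' : Int.negSucc k = -((k + 1 : ℕ) : ℤ) := by omega
    rw [h, h', Yfun_neg_natCast, Yfun_neg_natCast, Yfun_natCast, Yfun_natCast,
      Finset.prod_range_succ]
    simp

/-- `Yfun y m k` is a quotient of values of the antiderivative `m ↦ Yfun y m m` of `y`. -/
theorem Yfun_eq_div (y : ℤ → G) (m k : ℤ) :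
    Yfun y m k = Yfun y m m / Yfun y (m - k) (m - k) := by
  have hnat : ∀ (k : ℕ) (m : ℤ), Yfun y m k = Yfun y m m / Yfun y (m - k) (m - k) := by
    intro k m
    induction k with
    | zero => simp [Yfun_zero]
    | succ k ih =>
      have h := Yfun_self_add_one y (m - (k + 1 : ℕ))
      rw [show m - ((k + 1 : ℕ) : ℤ) + 1 = m - k by push_cast; ring] at h
      rw [Yfun_natCast, Finset.prod_range_succ, ← Yfun_natCast, ih, h, div_mul_eq_div_div,
        div_mul_cancel]
  obtain ⟨l, rfl | rfl⟩ := Int.eq_nat_or_neg k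
  · exact hnat l m
  · rw [Yfun_neg_natCast, hnat, inv_div, add_sub_cancel_right, sub_neg_eq_add]

theorem IsPartition.Ynl_eq_prod {f : ℕ → ℕ} (hf : IsPartition f) {N : ℕ} (hN : f N = 0)
    (y : ℤ → G) (n : ℤ) :
    Ynl y f n = ∏ k ∈ Finset.range N, Yfun y ((f k : ℤ) - ((k : ℤ) + 1) + n) (f k) := by
  have hlen : plength f = ucount f 1 := by simp only [plength, ucount, Nat.one_le_iff_ne_zero]
  have hpos := hf.le_iff_lt_ucount le_rfl
  rw [Ynl, hlen]
  refine Finset.prod_subset (Finset.range_subset_range.mpr ?_) fun k _ hk => ?_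
  · have := hpos N
    omega
  · have h : f k = 0 := by
      have := hpos k
      rw [Finset.mem_range] at hk
      omega
    rw [h, Nat.cast_zero, Yfun_zero]

/-- Reindexing over the shifted contents `λ_k - k`: those of `λ↑i` are those of `λ` lowered by
one, together with the one of the inserted part. -/
@[to_additive]
theorem IsPartition.prod_upP {M : Type*} [CommMonoid M] {f : ℕ → ℕ} (hf : IsPartition f) {i : ℕ}
    (hi : 1 ≤ i) {N : ℕ} (hN : ucount f i ≤ N) (φ : ℤ → M) :
    ∏ k ∈ Finset.range (N + 1), φ ((_root_.upP f i k : ℤ) - k) =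
      (∏ k ∈ Finset.range N, φ ((f k : ℤ) - k - 1)) * φ ((i : ℤ) - 1 - ucount f i) := by
  induction N, hN using Nat.le_induction with
  | base =>
    rw [Finset.prod_range_succ]
    congr 1
    · refine Finset.prod_congr rfl fun k hk => ?_
      rw [Finset.mem_range] at hk
      have := (hf.le_iff_lt_ucount hi k).mpr hk
      rw [_root_.upP, if_pos hk]
      congr 1
      omega
    · rw [_root_.upP, if_neg (lt_irrefl _), if_pos rfl]
      congr 1
      omega
  | succ N hN ih =>
    rw [Finset.prod_range_succ, ih, Finset.prod_range_succ _ N, mul_right_comm]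
    rw [_root_.upP, if_neg (by omega), if_neg (by omega), Nat.add_sub_cancel]
    congr 3
    push_cast
    ring

/-- Lemma 3.4: for every integer `n`, every integer `i ≥ 1` and every partition `λ`,
`Y_n(λ↑i) Y_{n-1}(λ)⁻¹ = Y(|λ↑i| - |λ| + n - 1, |λ↑i| - |λ|)`. -/
theorem Ynl_upP_ratio {G : Type*} [CommGroup G] (y : ℤ → G) (n : ℤ)
    (f : ℕ → ℕ) (hf : IsPartition f) (i : ℕ) (hi : 1 ≤ i) :
    Ynl y (upP f i) n * (Ynl y f (n - 1))⁻¹ =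
      Yfun y ((psize (upP f i) : ℤ) - (psize f : ℤ) + n - 1)
        ((psize (upP f i) : ℤ) - (psize f : ℤ)) := by
  obtain ⟨N₀, hN₀⟩ := hf.2
  set u := ucount f i with hu
  set N := N₀ + u with hN
  have hfN : f N = 0 := Nat.le_zero.mp (hN₀ ▸ hf.antitone (Nat.le_add_right N₀ u))
  have huN : u ≤ N := Nat.le_add_left u N₀
  have hup : upP f i (N + 1) = 0 := by
    rw [upP, if_neg (by omega), if_neg (by omega), Nat.add_sub_cancel, hfN]
  have hsize : (psize (upP f i) : ℤ) - psize f = (i : ℤ) - 1 - u := by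
    have h := hf.sum_upP hi huN id
    simp only [id, Finset.sum_sub_distrib, Finset.sum_range_succ _ N] at h
    rw [(hf.upP hi).psize_eq_sum hup, hf.psize_eq_sum hfN, Finset.sum_range_succ]
    push_cast
    simp at h
    linarith
  set P : ℤ → G := fun m => Yfun y m m with hP
  have hY : ∀ m k, Yfun y m k = P m / P (m - k) := Yfun_eq_div y
  have hnum := hf.prod_upP hi huN fun m => P (m - 1 + n)
  have hden : ∏ k ∈ Finset.range (N + 1), P (n - 1 - k) =
      (∏ k ∈ Finset.range N, P (n - 1 - 1 - k)) * P (n - 1) := by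
    rw [Finset.prod_range_succ']
    congr 1
    · refine Finset.prod_congr rfl fun k _ => congrArg P ?_
      push_cast
      ring
    · simp
  have hlhs : Ynl y (upP f i) n =
      (∏ k ∈ Finset.range (N + 1), P ((upP f i k : ℤ) - k - 1 + n)) /
        ∏ k ∈ Finset.range (N + 1), P (n - 1 - k) := by
    rw [(hf.upP hi).Ynl_eq_prod hup, ← Finset.prod_div_distrib]
    refine Finset.prod_congr rfl fun k _ => ?_
    rw [hY]
    congr 2 <;> ring
  have hrhs : Ynl y f (n - 1) =
      (∏ k ∈ Finset.range N, P ((f k : ℤ) - k - 1 - 1 + n)) /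
        ∏ k ∈ Finset.range N, P (n - 1 - 1 - k) := by
    rw [hf.Ynl_eq_prod hfN, ← Finset.prod_div_distrib]
    refine Finset.prod_congr rfl fun k _ => ?_
    rw [hY]
    congr 2 <;> ring
  rw [hlhs, hrhs, hnum, hden, hsize, hY, ← div_eq_mul_inv, mul_div_mul_comm, mul_div_cancel_left]
  congr 2 <;> ring
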